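/- Let p be an odd prime, m ∈ ℕ, and β ∈ ℤ. Set S = ∑_{b=0}^{p^m−1} (b | p^m)·e(bβ/p^m). Then: S = φ(p^m) if p^m | β and m is even; S = −p^{m−1} if β ≠ 0, v_p(β) = m−1 and m is even; S = ((β/p^{m−1}) | p)·η(p)·p^{m−1/2} if β ≠ 0, v_p(β) = m−1 and m is odd; and S = 0 in all other cases (i.e., if v_p(β) < m−1, or if p^m | β and m is odd). -/

import Mathlib

/-- `e(t) = e^{2πit}`. -/
noncomputable def e2 (t : ℝ) : ℂ := Complex.exp (2 * Real.pi * Complex.I * t)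

/-- `η(n)` is the complex conjugate of `(1 + i^n)/(1 + i)`. -/
noncomputable def eta (n : ℕ) : ℂ :=
  starRingEnd ℂ ((1 + Complex.I ^ n) / (1 + Complex.I))

/-- q-factorial product. -/
noncomputable def qF (q : ℂ) (n : ℕ) : ℂ := ∏ i ∈ Finset.range n, (1 - q ^ (i + 1))

/-- q-binomial. -/
noncomputable def qB (q : ℂ) (n j : ℕ) : ℂ := qF q n / (qF q j * qF q (n - j))

lemma qF_succ (q : ℂ) (n : ℕ) : qF q (n + 1) = qF q n * (1 - q ^ (n + 1)) := by
  simp [qF, Finset.prod_range_succ]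

lemma qF_ne (q : ℂ) (N : ℕ) (h : ∀ i, 0 < i → i ≤ N → q ^ i ≠ 1) (n : ℕ) (hn : n ≤ N) :
    qF q n ≠ 0 := by
  rw [qF, Finset.prod_ne_zero_iff]
  intro i hi
  rw [Finset.mem_range] at hi
  exact sub_ne_zero.mpr (Ne.symm (h _ (by omega) (by omega)))

lemma qB_zero (q : ℂ) (N : ℕ) (h : ∀ i, 0 < i → i ≤ N → q ^ i ≠ 1) (n : ℕ) (hn : n ≤ N) :
    qB q n 0 = 1 := by
  have := qF_ne q N h n hn
  simp only [qB, Nat.sub_zero]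
  rw [show qF q 0 = 1 by simp [qF]]
  field_simp

lemma qB_self (q : ℂ) (N : ℕ) (h : ∀ i, 0 < i → i ≤ N → q ^ i ≠ 1) (n : ℕ) (hn : n ≤ N) :
    qB q n n = 1 := by
  have := qF_ne q N h n hn
  simp only [qB, Nat.sub_self]
  rw [show qF q 0 = 1 by simp [qF]]
  field_simp

lemma qB_pascal (q : ℂ) (N : ℕ) (h : ∀ i, 0 < i → i ≤ N → q ^ i ≠ 1) (n j : ℕ) (hn : n + 1 ≤ N)
    (hj : j < n) : qB q (n + 1) (j + 1) = qB q n (j + 1) + q ^ (n - j) * qB q n j := by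
  obtain ⟨d, rfl⟩ : ∃ d, n = j + d + 1 := ⟨n - j - 1, by omega⟩
  have h1 := qF_ne q N h (j + 1) (by omega)
  have h2 := qF_ne q N h (d + 1) (by omega)
  have h3 := qF_ne q N h (j + d + 1) (by omega)
  simp only [qB]
  rw [show j + d + 1 + 1 - (j + 1) = d + 1 by omega, show j + d + 1 - (j + 1) = d by omega,
    show j + d + 1 - j = d + 1 by omega, qF_succ q (j + d + 1)]
  rw [qF_succ] at h1 h2
  rw [qF_succ q j, qF_succ q d]
  have a1 := left_ne_zero_of_mul h1
  have a2 := right_ne_zero_of_mul h1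
  have a3 := left_ne_zero_of_mul h2
  have a4 := right_ne_zero_of_mul h2
  field_simp
  ring

lemma qB_absorb (q : ℂ) (N : ℕ) (h : ∀ i, 0 < i → i ≤ N → q ^ i ≠ 1) (n j : ℕ) (hn : n + 1 ≤ N)
    (hj : j ≤ n) : (1 - q ^ (n + 1 - j)) * qB q (n + 1) j = (1 - q ^ (n + 1)) * qB q n j := by
  obtain ⟨d, rfl⟩ : ∃ d, n = j + d := ⟨n - j, by omega⟩
  have h1 := qF_ne q N h j (by omega)
  have h2 := qF_ne q N h (d + 1) (by omega)
  simp only [qB]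
  rw [show j + d + 1 - j = d + 1 by omega, show j + d - j = d by omega, qF_succ q (j + d)]
  rw [qF_succ] at h2
  rw [qF_succ q d]
  have a3 := left_ne_zero_of_mul h2
  have a4 := right_ne_zero_of_mul h2
  field_simp

lemma qB_step (q : ℂ) (N : ℕ) (h : ∀ i, 0 < i → i ≤ N → q ^ i ≠ 1) (n j : ℕ) (hn : n ≤ N)
    (hj : j < n) : (1 - q ^ (j + 1)) * qB q n (j + 1) = (1 - q ^ (n - j)) * qB q n j := by
  obtain ⟨d, rfl⟩ : ∃ d, n = j + d + 1 := ⟨n - j - 1, by omega⟩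
  have h1 := qF_ne q N h (j + 1) (by omega)
  have h2 := qF_ne q N h (d + 1) (by omega)
  simp only [qB]
  rw [show j + d + 1 - (j + 1) = d by omega,
    show j + d + 1 - j = d + 1 by omega]
  rw [qF_succ] at h1 h2
  rw [qF_succ q j, qF_succ q d]
  have a1 := left_ne_zero_of_mul h1
  have a2 := right_ne_zero_of_mul h1
  have a3 := left_ne_zero_of_mul h2
  have a4 := right_ne_zero_of_mul h2
  field_simp

lemma qf_rec (q : ℂ) (N : ℕ) (h : ∀ i, 0 < i → i ≤ N → q ^ i ≠ 1) (n : ℕ) (hn : n + 2 ≤ N) :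
    ∑ j ∈ Finset.range (n + 3), (-1) ^ j * qB q (n + 2) j =
      (1 - q ^ (n + 1)) * ∑ j ∈ Finset.range (n + 1), (-1) ^ j * qB q n j := by
  have e1 : ∑ j ∈ Finset.range (n + 3), (-1) ^ j * qB q (n + 2) j =
      ∑ j ∈ Finset.range (n + 2), (-1) ^ j * qB q (n + 1) j
      - ∑ j ∈ Finset.range (n + 2), (-1) ^ j * (q ^ (n + 1 - j) * qB q (n + 1) j) := by
    rw [Finset.sum_range_succ, Finset.sum_range_succ',
      Finset.sum_range_succ' (fun j => (-1) ^ j * qB q (n + 1) j),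
      Finset.sum_range_succ (fun j => (-1) ^ j * (q ^ (n + 1 - j) * qB q (n + 1) j)),
      qB_self q N h _ hn, qB_self q N h _ (by omega), qB_zero q N h _ hn,
      qB_zero q N h _ (by omega)]
    rw [Finset.sum_congr rfl (fun j hj => by
      rw [qB_pascal q N h (n + 1) j (by omega) (Finset.mem_range.mp hj)])]
    simp only [mul_add, Finset.sum_add_distrib, pow_succ, mul_neg, neg_mul, mul_one,
      Finset.sum_neg_distrib, Nat.sub_self, pow_zero]
    ring
  rw [e1, ← Finset.sum_sub_distrib, Finset.sum_range_succ, Finset.mul_sum]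
  simp only [Nat.sub_self, pow_zero, one_mul, sub_self, add_zero]
  refine Finset.sum_congr rfl fun j hj => ?_
  have := qB_absorb q N h n j (by omega) (by rw [Finset.mem_range] at hj; omega)
  linear_combination (-1) ^ j * this

lemma qf_eval (q : ℂ) (n : ℕ) (h : ∀ i, 0 < i → i ≤ 2 * n → q ^ i ≠ 1) :
    ∑ j ∈ Finset.range (2 * n + 1), (-1) ^ j * qB q (2 * n) j =
      ∏ k ∈ Finset.range n, (1 - q ^ (2 * k + 1)) := by
  induction n with
  | zero => simp [qB, qF]
  | succ n ih =>
    have := qf_rec q (2 * n + 2) h (2 * n) le_rfl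
    rw [show 2 * (n + 1) + 1 = 2 * n + 3 by ring, show 2 * (n + 1) = 2 * n + 2 by ring, this,
      ih (fun i h1 h2 => h i h1 (by omega)), Finset.prod_range_succ]
    ring

/-- Evaluation of the quadratic exponential sum as a product. -/
lemma quad_prod (z : ℂ) (n : ℕ) (hz : IsPrimitiveRoot z (2 * n + 1)) :
    ∑ j ∈ Finset.range (2 * n + 1), z ^ ((j + n + 1) ^ 2) =
      ∏ k ∈ Finset.range n, (z ^ (2 * k + 1) - (z ^ (2 * k + 1))⁻¹) := by
  have hz0 : z ≠ 0 := hz.ne_zero (by omega)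
  have hzp : z ^ (2 * n + 1) = 1 := hz.pow_eq_one
  obtain ⟨q, hq⟩ : ∃ q, q = (z ^ 2)⁻¹ := ⟨_, rfl⟩
  have hqp : q ^ (2 * n + 1) = 1 := by
    rw [hq, inv_pow, ← pow_mul, mul_comm, pow_mul, hzp]; simp
  have hprim : IsPrimitiveRoot q (2 * n + 1) := by
    rw [hq]
    exact (hz.pow_of_coprime 2 (by simp)).inv
  have hne : ∀ i, 0 < i → i ≤ 2 * n → q ^ i ≠ 1 := fun i h1 h2 =>
    hprim.pow_ne_one_of_pos_of_lt (by omega) (by omega)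
  have key : ∀ j, j ≤ 2 * n → (-1) ^ j * qB q (2 * n) j = z ^ (j * (j + 1)) := by
    intro j
    induction j with
    | zero => intro _; simp [qB_zero q (2 * n) hne (2 * n) le_rfl]
    | succ j ih =>
      intro hj
      have ih := ih (by omega)
      have st := qB_step q (2 * n) hne (2 * n) j le_rfl (by omega)
      have hnz : 1 - q ^ (j + 1) ≠ 0 := sub_ne_zero.mpr (Ne.symm (hne _ (by omega) (by omega)))
      have hqz : q ^ (j + 1) * z ^ (2 * (j + 1)) = 1 := by
        rw [hq, pow_mul, inv_pow]; field_simp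
      have hqq : q ^ (2 * n - j) = z ^ (2 * (j + 1)) := by
        have : q ^ (2 * n - j) * q ^ (j + 1) = 1 := by
          rw [← pow_add, show 2 * n - j + (j + 1) = 2 * n + 1 by omega, hqp]
        have hq0 : q ^ (j + 1) ≠ 0 := left_ne_zero_of_mul_eq_one hqz
        apply mul_right_cancel₀ hq0
        rw [this, mul_comm, hqz]
      apply mul_left_cancel₀ hnz
      rw [show (j + 1) * (j + 1 + 1) = j * (j + 1) + 2 * (j + 1) by ring, pow_add z, ← ih,
        ]
      rw [hqq] at st
      linear_combination (-1) ^ (j + 1) * st + (-1) ^ j * qB q (2 * n) j * hqz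
  have ev := qf_eval q n hne
  rw [Finset.sum_congr rfl (fun j hj => key j (by rw [Finset.mem_range] at hj; omega))] at ev
  have lhs : ∑ j ∈ Finset.range (2 * n + 1), z ^ ((j + n + 1) ^ 2) =
      z ^ (n ^ 2) * ∑ j ∈ Finset.range (2 * n + 1), z ^ (j * (j + 1)) := by
    rw [Finset.mul_sum]
    refine Finset.sum_congr rfl fun j _ => ?_
    rw [show (j + n + 1) ^ 2 = n ^ 2 + j * (j + 1) + (2 * n + 1) * (j + 1) by ring, pow_add,
      pow_mul z (2 * n + 1), hzp, pow_add]
    simp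
  have hsum : ∀ n : ℕ, z ^ (n ^ 2) = ∏ k ∈ Finset.range n, z ^ (2 * k + 1) := by
    intro n
    induction n with
    | zero => simp
    | succ n ih => rw [Finset.prod_range_succ, ← ih, ← pow_add]; congr 1; ring
  rw [lhs, ev, hsum, ← Finset.prod_mul_distrib]
  refine Finset.prod_congr rfl fun k _ => ?_
  rw [hq, mul_sub, mul_one, inv_pow, ← pow_mul, mul_comm 2, pow_mul]
  congr 1
  field_simp
  ring

lemma sum_range_zmod (N : ℕ) [NeZero N] (f : ZMod N → ℂ) :
    ∑ j ∈ Finset.range N, f (j : ZMod N) = ∑ x : ZMod N, f x := by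
  refine Finset.sum_bij' (fun j _ => (j : ZMod N)) (fun x _ => x.val) ?_ ?_ ?_ ?_ ?_
  · simp
  · intro x _; simpa using ZMod.val_lt x
  · intro j hj; exact ZMod.val_cast_of_lt (Finset.mem_range.mp hj)
  · intro x _; simp
  · simp

lemma sin_pair (p a b : ℝ) (ha : 0 < a) (ha' : 2 * a < p) (hb : p < 2 * b) (hb' : b < p) :
    0 < Real.sin (2 * Real.pi * a / p) ∧ Real.sin (2 * Real.pi * b / p) < 0 := by
  have hp : 0 < p := by linarith
  have hpi := Real.pi_pos
  constructor
  · apply Real.sin_pos_of_pos_of_lt_pi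
    · positivity
    · rw [div_lt_iff₀ hp]; nlinarith
  · have : 0 < Real.sin (2 * Real.pi * b / p - Real.pi) := by
      apply Real.sin_pos_of_pos_of_lt_pi
      · rw [sub_pos, lt_div_iff₀ hp]; nlinarith
      · rw [sub_lt_iff_lt_add, div_lt_iff₀ hp]; nlinarith
    rw [Real.sin_sub_pi] at this
    linarith

lemma pos_prod (n : ℕ) : ∃ P : ℝ, 0 < P ∧
    ∏ k ∈ Finset.range n, (2 * Complex.I *
      ((Real.sin (2 * Real.pi * (2 * k + 1) / (2 * n + 1)) : ℝ) : ℂ)) =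
      (if Even n then 1 else Complex.I) * (P : ℂ) := by
  rcases Nat.even_or_odd' n with ⟨l, rfl | rfl⟩
  · rw [two_mul, Finset.prod_range_add, ← Finset.prod_mul_distrib]
    refine ⟨∏ k ∈ Finset.range l, (-4 * (Real.sin (2 * Real.pi * (2 * k + 1) / (2 * (l + l : ℕ) + 1)) * Real.sin (2 * Real.pi * (2 * (l + k : ℕ) + 1) / (2 * (l + l : ℕ) + 1)))), ?_, ?_⟩
    · refine Finset.prod_pos fun k hk => ?_
      rw [Finset.mem_range] at hk
      have hk' : (k : ℝ) + 1 ≤ l := by exact_mod_cast hk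
      have hk0 : (0 : ℝ) ≤ k := by positivity
      have := sin_pair (2 * (l + l : ℕ) + 1) (2 * k + 1) (2 * (l + k : ℕ) + 1) (by positivity)
        (by push_cast; linarith) (by push_cast; linarith) (by push_cast; linarith)
      have := mul_neg_of_pos_of_neg this.1 this.2
      linarith
    · rw [if_pos (by simp), one_mul, Complex.ofReal_prod]
      refine Finset.prod_congr rfl fun k _ => ?_
      push_cast
      linear_combination (4 * Complex.sin (2 * Real.pi * (2 * k + 1) / (2 * (l + l) + 1)) * Complex.sin (2 * Real.pi * (2 * (l + k) + 1) / (2 * (l + l) + 1))) * Complex.I_sq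
  · rw [show 2 * l + 1 = (l + 1) + l by ring, Finset.prod_range_add, Finset.prod_range_succ,
      mul_right_comm, ← Finset.prod_mul_distrib]
    refine ⟨(∏ k ∈ Finset.range l, (-4 * (Real.sin (2 * Real.pi * (2 * k + 1) / (2 * (l + 1 + l : ℕ) + 1)) * Real.sin (2 * Real.pi * (2 * (l + 1 + k : ℕ) + 1) / (2 * (l + 1 + l : ℕ) + 1))))) * (2 * Real.sin (2 * Real.pi * (2 * l + 1) / (2 * (l + 1 + l : ℕ) + 1))), ?_, ?_⟩
    · apply mul_pos
      · refine Finset.prod_pos fun k hk => ?_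
        rw [Finset.mem_range] at hk
        have hk' : (k : ℝ) + 1 ≤ l := by exact_mod_cast hk
        have hk0 : (0 : ℝ) ≤ k := by positivity
        have := sin_pair (2 * (l + 1 + l : ℕ) + 1) (2 * k + 1) (2 * (l + 1 + k : ℕ) + 1)
          (by positivity)
          (by push_cast; linarith) (by push_cast; linarith) (by push_cast; linarith)
        have := mul_neg_of_pos_of_neg this.1 this.2
        linarith
      · have hl0 : (0 : ℝ) ≤ l := by positivity
        have := (sin_pair (2 * (l + 1 + l : ℕ) + 1) (2 * l + 1) (2 * l + 2) (by positivity)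
          (by push_cast; linarith) (by push_cast; linarith) (by push_cast; linarith)).1
        linarith
    · rw [if_neg (by rw [Nat.not_even_iff_odd]; exact ⟨l, by ring⟩), Complex.ofReal_mul,
        Complex.ofReal_prod, mul_left_comm Complex.I]
      refine congrArg₂ (· * ·) ?_ ?_
      · refine Finset.prod_congr rfl fun k _ => ?_
        push_cast
        linear_combination (4 * Complex.sin (2 * Real.pi * (2 * k + 1) / (2 * (l + 1 + l) + 1)) * Complex.sin (2 * Real.pi * (2 * (l + 1 + k) + 1) / (2 * (l + 1 + l) + 1))) * Complex.I_sq
      · push_cast; ring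

/-- The complex-valued quadratic character. -/
noncomputable def qchi (p : ℕ) [Fact p.Prime] : MulChar (ZMod p) ℂ :=
  (quadraticChar (ZMod p)).ringHomComp (Int.castRingHom ℂ)

lemma qchi_apply (p : ℕ) [Fact p.Prime] (x : ZMod p) :
    qchi p x = ((quadraticChar (ZMod p) x : ℤ) : ℂ) := rfl

lemma qchi_zero (p : ℕ) [Fact p.Prime] : qchi p 0 = 0 := by
  simp [qchi_apply]

lemma gauss_eq_quad (p : ℕ) [Fact p.Prime] (hp2 : p ≠ 2) :
    gaussSum (qchi p) (ZMod.stdAddChar (N := p)) = ∑ x : ZMod p, ZMod.stdAddChar (x ^ 2) := by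
  have h1 : ∑ x : ZMod p, (ZMod.stdAddChar (x ^ 2) : ℂ) =
      ∑ a : ZMod p, (qchi p a + 1) * ZMod.stdAddChar a := by
    rw [← Finset.sum_fiberwise (s := Finset.univ) (g := fun x : ZMod p => x ^ 2)]
    refine Finset.sum_congr rfl fun a _ => ?_
    rw [Finset.sum_congr rfl (g := fun _ => (ZMod.stdAddChar a : ℂ))
      (fun x hx => by rw [(Finset.mem_filter.mp hx).2]), Finset.sum_const, nsmul_eq_mul]
    congr 1
    have := quadraticChar_card_sqrts (F := ZMod p) (by rwa [ZMod.ringChar_zmod_n]) a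
    rw [qchi_apply]
    have h2 : Finset.univ.filter (fun x : ZMod p => x ^ 2 = a) = {x : ZMod p | x ^ 2 = a}.toFinset := by
      ext; simp
    rw [h2]
    exact_mod_cast this
  rw [h1]
  simp only [add_mul, one_mul, Finset.sum_add_distrib, gaussSum]
  rw [AddChar.sum_eq_zero_of_ne_one, add_zero]
  have := ZMod.isPrimitive_stdAddChar p (a := 1) one_ne_zero
  simpa using this

lemma std_pow (p : ℕ) [NeZero p] (k : ℕ) :
    (ZMod.stdAddChar ((k : ℕ) : ZMod p) : ℂ) = (Complex.exp (2 * Real.pi * Complex.I / p)) ^ k := by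
  have := ZMod.stdAddChar_coe (N := p) k
  rw [← Complex.exp_nat_mul]
  push_cast at this
  rw [this]
  congr 1; ring

lemma eta_eq (n : ℕ) : eta (2 * n + 1) = if Even n then 1 else Complex.I := by
  have hI : (1 + Complex.I) ≠ 0 := by
    intro h; have := congrArg Complex.re h; simp at this
  rw [eta, pow_succ, pow_mul, Complex.I_sq]
  split_ifs with h
  · rw [h.neg_one_pow, one_mul, div_self hI]; simp
  · rw [(Nat.not_even_iff_odd.mp h).neg_one_pow]
    have : (1 + -1 * Complex.I) / (1 + Complex.I) = - Complex.I := by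
      rw [div_eq_iff hI]; linear_combination Complex.I_sq
    rw [this]; simp

lemma gauss_eval (p : ℕ) [Fact p.Prime] (hp2 : p ≠ 2) :
    gaussSum (qchi p) (ZMod.stdAddChar (N := p)) = eta p * ((Real.sqrt p : ℝ) : ℂ) := by
  obtain ⟨n, hn⟩ : Odd p := (Fact.out : p.Prime).odd_of_ne_two hp2
  have hprim := Complex.isPrimitiveRoot_exp p (NeZero.ne p)
  have hG : ∃ P : ℝ, 0 < P ∧ gaussSum (qchi p) (ZMod.stdAddChar (N := p)) = eta p * P := by
    obtain ⟨P, hP, hPe⟩ := pos_prod n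
    refine ⟨P, hP, ?_⟩
    rw [gauss_eq_quad p hp2]
    have : ∑ x : ZMod p, (ZMod.stdAddChar (x ^ 2) : ℂ) =
        ∑ j ∈ Finset.range p, Complex.exp (2 * Real.pi * Complex.I / p) ^ ((j + n + 1) ^ 2) := by
      rw [← Equiv.sum_comp (Equiv.addRight ((n + 1 : ℕ) : ZMod p)), ← sum_range_zmod]
      refine Finset.sum_congr rfl fun j _ => ?_
      rw [← std_pow]
      simp [add_assoc]
    rw [this]
    have h2 := quad_prod (Complex.exp (2 * Real.pi * Complex.I / p)) n (hn ▸ hprim)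
    rw [← hn] at h2
    rw [h2, hn, eta_eq, ← hPe]
    refine Finset.prod_congr rfl fun k _ => ?_
    rw [← Complex.exp_nat_mul, ← Complex.exp_neg, Complex.ofReal_sin, Complex.sin]
    have e1 : (((2 * k + 1 : ℕ) : ℂ) * (2 * Real.pi * Complex.I / ((2 * n + 1 : ℕ) : ℂ))) =
      ((2 * Real.pi * (2 * k + 1) / (2 * n + 1) : ℝ) : ℂ) * Complex.I := by
      push_cast; ring
    rw [e1, neg_mul]
    linear_combination (-Complex.exp (-(((2 * Real.pi * (2 * k + 1) / (2 * n + 1) : ℝ) : ℂ) * Complex.I)) + Complex.exp ((((2 * Real.pi * (2 * k + 1) / (2 * n + 1) : ℝ) : ℂ) * Complex.I))) * Complex.I_sq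
  obtain ⟨P, hP, hPe⟩ := hG
  have hnorm : ‖gaussSum (qchi p) (ZMod.stdAddChar (N := p))‖ ^ 2 = p := by
    have hchi : qchi p ≠ 1 := by
      have := quadraticChar_ne_one (F := ZMod p) (by rwa [ZMod.ringChar_zmod_n])
      rw [qchi]
      exact (MulChar.ringHomComp_ne_one_iff (RingHom.injective_int _)).mpr this
    have h3 := gaussSum_mul_gaussSum_eq_card hchi (ZMod.isPrimitive_stdAddChar p)
    rw [← star_gaussSum_eq, ZMod.card] at h3
    have h4 := Complex.mul_conj' (gaussSum (qchi p) (ZMod.stdAddChar (N := p)))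
    rw [starRingEnd_apply, h3] at h4
    exact_mod_cast h4.symm
  have heta : ‖eta p‖ = 1 := by
    rw [hn, eta_eq]; split_ifs <;> simp
  rw [hPe, norm_mul, heta, one_mul, Complex.norm_real, Real.norm_of_nonneg hP.le] at hnorm
  rw [hPe, ← hnorm, Real.sqrt_sq hP.le]

lemma e2_add (s t : ℝ) : e2 (s + t) = e2 s * e2 t := by
  rw [e2, e2, e2, ← Complex.exp_add]; push_cast; congr 1; ring

lemma e2_int (n : ℤ) : e2 n = 1 := by
  rw [e2, Complex.exp_eq_one_iff]
  exact ⟨n, by push_cast; ring⟩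

lemma e2_std (N : ℕ) [NeZero N] (j : ℤ) : e2 ((j : ℝ) / N) = ZMod.stdAddChar (j : ZMod N) := by
  rw [ZMod.stdAddChar_coe, e2]; push_cast; congr 1; ring

lemma geo_sum (N : ℕ) [NeZero N] (β : ℤ) :
    ∑ k ∈ Finset.range N, e2 (((k * β : ℤ) : ℝ) / N) = if (N : ℤ) ∣ β then (N : ℂ) else 0 := by
  have h := AddChar.sum_mulShift (ψ := (ZMod.stdAddChar (N := N) : AddChar (ZMod N) ℂ))
    (β : ZMod N) (ZMod.isPrimitive_stdAddChar N)
  rw [← sum_range_zmod] at h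
  rw [ZMod.card] at h
  simp only [ZMod.intCast_zmod_eq_zero_iff_dvd] at h
  have h' : ∑ k ∈ Finset.range N, e2 (((k * β : ℤ) : ℝ) / N)
      = ∑ j ∈ Finset.range N, (ZMod.stdAddChar ((j : ZMod N) * (β : ZMod N)) : ℂ) := by
    refine Finset.sum_congr rfl fun k _ => ?_
    rw [e2_std]; push_cast; rfl
  rw [h', h]
  split_ifs <;> simp

lemma sum_range_mul_aux (p M : ℕ) (hp : 0 < p) (f : ℕ → ℂ) :
    ∑ b ∈ Finset.range (p * M), f b =
      ∑ r ∈ Finset.range p, ∑ k ∈ Finset.range M, f (r + p * k) := by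
  induction M with
  | zero => simp
  | succ M ih =>
    rw [Nat.mul_succ, Finset.sum_range_add, ih]
    simp only [Finset.sum_range_succ, Finset.sum_add_distrib]
    congr 1
    exact Finset.sum_congr rfl fun r _ => by rw [add_comm]

lemma S_eq (p : ℕ) (hp : p.Prime) (n : ℕ) (β : ℤ) :
    ∑ b ∈ Finset.range (p ^ (n + 1)),
      ((jacobiSym (b : ℤ) (p ^ (n + 1)) : ℤ) : ℂ) * e2 (((b * β : ℤ) : ℝ) / (p : ℝ) ^ (n + 1)) =
    (∑ r ∈ Finset.range p, ((jacobiSym (r : ℤ) p : ℤ) : ℂ) ^ (n + 1) *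
      e2 (((r * β : ℤ) : ℝ) / (p : ℝ) ^ (n + 1))) *
      if (p : ℤ) ^ n ∣ β then (p : ℂ) ^ n else 0 := by
  have hp0 : (p : ℝ) ≠ 0 := by exact_mod_cast hp.ne_zero
  have : NeZero (p ^ n) := ⟨pow_ne_zero _ hp.ne_zero⟩
  have hg := geo_sum (p ^ n) β
  push_cast at hg
  rw [← hg, pow_succ' p n, sum_range_mul_aux p _ hp.pos, Finset.sum_mul]
  refine Finset.sum_congr rfl fun r _ => ?_
  rw [Finset.mul_sum]
  refine Finset.sum_congr rfl fun k _ => ?_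
  rw [← pow_succ' p n, jacobiSym.pow_right,
    jacobiSym.mod_left' (a₁ := ((r + p * k : ℕ) : ℤ)) (a₂ := (r : ℤ)) (by push_cast; simp)]
  rw [mul_assoc, ← e2_add]
  push_cast
  congr 2
  rw [pow_succ]
  field_simp

lemma S_eq' (p : ℕ) (hp : p.Prime) (n : ℕ) (γ : ℤ) :
    ∑ b ∈ Finset.range (p ^ (n + 1)),
      ((jacobiSym (b : ℤ) (p ^ (n + 1)) : ℤ) : ℂ) *
        e2 (((b * ((p : ℤ) ^ n * γ) : ℤ) : ℝ) / (p : ℝ) ^ (n + 1)) =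
    (p : ℂ) ^ n * ∑ r ∈ Finset.range p, ((jacobiSym (r : ℤ) p : ℤ) : ℂ) ^ (n + 1) *
      e2 (((r * γ : ℤ) : ℝ) / p) := by
  have hp0 : (p : ℝ) ≠ 0 := by exact_mod_cast hp.ne_zero
  rw [S_eq p hp, if_pos (Dvd.intro _ rfl), mul_comm]
  congr 1
  refine Finset.sum_congr rfl fun r _ => ?_
  congr 2
  push_cast
  rw [pow_succ]
  field_simp

lemma jac_chi (p : ℕ) [Fact p.Prime] (a : ℤ) : ((jacobiSym a p : ℤ) : ℂ) = qchi p (a : ZMod p) := by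
  rw [← jacobiSym.legendreSym.to_jacobiSym, legendreSym, qchi_apply]

lemma even_sum (p : ℕ) (hp : p.Prime) (n : ℕ) (hn : Even (n + 1)) (γ : ℤ) :
    ∑ r ∈ Finset.range p, ((jacobiSym (r : ℤ) p : ℤ) : ℂ) ^ (n + 1) *
      e2 (((r * γ : ℤ) : ℝ) / p) = (if (p : ℤ) ∣ γ then (p : ℂ) else 0) - 1 := by
  have : Fact p.Prime := ⟨hp⟩
  rw [← geo_sum p γ, eq_sub_iff_add_eq]
  obtain ⟨q, rfl⟩ : ∃ q, p = q + 1 := ⟨p - 1, by have := hp.pos; omega⟩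
  rw [Finset.sum_range_succ', Finset.sum_range_succ']
  have h0 : ((jacobiSym ((0 : ℕ) : ℤ) (q + 1) : ℤ) : ℂ) = 0 := by
    rw [jac_chi]; simp [qchi_zero]
  rw [h0]
  have e0 : e2 ((((0 : ℕ) * γ : ℤ) : ℝ) / ((q + 1 : ℕ) : ℝ)) = 1 := by simp [e2]
  rw [e0, zero_pow (by omega), zero_mul, add_zero]
  congr 1
  refine Finset.sum_congr rfl fun r hr => ?_
  obtain ⟨k, hk⟩ := hn
  have : ((jacobiSym ((r + 1 : ℕ) : ℤ) (q + 1) : ℤ) : ℂ) ^ (n + 1) = 1 := by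
    have hsq := jacobiSym.sq_one (a := ((r + 1 : ℕ) : ℤ)) (b := q + 1) (by
      rw [Int.gcd_natCast_natCast]
      rw [Finset.mem_range] at hr
      exact (Nat.coprime_of_lt_prime (by omega) (by omega) hp).symm)
    rw [hk, ← two_mul, pow_mul]
    rw [← Int.cast_pow, hsq]; simp
  rw [this, one_mul]

lemma odd_sum (p : ℕ) (hp : p.Prime) (hp2 : p ≠ 2) (n : ℕ) (hn : Odd (n + 1)) (γ : ℤ) :
    ∑ r ∈ Finset.range p, ((jacobiSym (r : ℤ) p : ℤ) : ℂ) ^ (n + 1) *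
      e2 (((r * γ : ℤ) : ℝ) / p) =
      ((jacobiSym γ p : ℤ) : ℂ) * (eta p * ((Real.sqrt p : ℝ) : ℂ)) := by
  have : Fact p.Prime := ⟨hp⟩
  have hquad : (qchi p).IsQuadratic := (quadraticChar_isQuadratic (ZMod p)).comp _
  have h1 : ∑ r ∈ Finset.range p, ((jacobiSym (r : ℤ) p : ℤ) : ℂ) ^ (n + 1) *
      e2 (((r * γ : ℤ) : ℝ) / p) = gaussSum (qchi p) (ZMod.stdAddChar.mulShift (γ : ZMod p)) := by
    rw [gaussSum, ← sum_range_zmod]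
    refine Finset.sum_congr rfl fun r _ => ?_
    rw [e2_std, jac_chi, AddChar.mulShift_apply]
    push_cast
    rw [mul_comm (γ : ZMod p)]
    congr 1
    obtain ⟨k, hk⟩ := hn
    rcases hquad (r : ZMod p) with h | h | h <;> rw [h] <;> simp [hk, pow_succ, pow_mul]
  rw [h1, jac_chi, ← gauss_eval p hp2]
  by_cases hγ : (γ : ZMod p) = 0
  · rw [hγ]
    have hchi : qchi p ≠ 1 := by
      have := quadraticChar_ne_one (F := ZMod p) (by rwa [ZMod.ringChar_zmod_n])
      rw [qchi]
      exact (MulChar.ringHomComp_ne_one_iff (RingHom.injective_int _)).mpr this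
    rw [AddChar.mulShift_zero, gaussSum_one_right hchi]
    simp [qchi_zero]
  · have := gaussSum_mulShift_eq (qchi p) (ZMod.stdAddChar (N := p)) (Units.mk0 _ hγ)
    rw [hquad.inv] at this
    exact this


/-- Evaluation of the twisted character sum
`S = ∑_{b mod p^m} (b | p^m)·e(bβ/p^m)` for an odd prime `p`. -/
theorem jacobi_twisted_sum_eval (p : ℕ) (hp : p.Prime) (hodd : Odd p) (m : ℕ)
    (β : ℤ) :
    let S : ℂ := ∑ b ∈ Finset.range (p ^ m),
      ((jacobiSym (b : ℤ) (p ^ m) : ℤ) : ℂ) * e2 (((b * β : ℤ) : ℝ) / (p : ℝ) ^ m)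
    (((p : ℤ) ^ m ∣ β → Even m → S = (Nat.totient (p ^ m) : ℂ)) ∧
      (β ≠ 0 → (padicValInt p β : ℤ) = (m : ℤ) - 1 → Even m →
        S = -((p : ℂ) ^ (m - 1))) ∧
      (β ≠ 0 → (padicValInt p β : ℤ) = (m : ℤ) - 1 → Odd m →
        S = ((jacobiSym (β / (p : ℤ) ^ (m - 1)) p : ℤ) : ℂ) * eta p *
          (((p : ℝ) ^ ((m : ℝ) - 1/2) : ℝ) : ℂ)) ∧
      (β ≠ 0 → (padicValInt p β : ℤ) < (m : ℤ) - 1 → S = 0) ∧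
      ((p : ℤ) ^ m ∣ β → Odd m → S = 0)) := by
  intro S
  have hp2 : p ≠ 2 := by rintro rfl; exact absurd hodd (by decide)
  have : Fact p.Prime := ⟨hp⟩
  have hpC : (p : ℂ) ≠ 0 := by exact_mod_cast hp.ne_zero
  have hpZ : (p : ℤ) ≠ 0 := by exact_mod_cast hp.ne_zero
  rcases m with _ | n
  · refine ⟨fun _ _ => ?_, fun _ h => ?_, fun _ h => ?_, fun _ h => ?_, fun _ h => ?_⟩
    · simp [S, e2]
    · omega
    · omega
    · omega
    · exact absurd h (by decide)
  have hdvd : β ≠ 0 → ∀ k : ℕ, (p : ℤ) ^ k ∣ β ↔ k ≤ padicValInt p β := by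
    intro h0 k
    rw [padicValInt_dvd_iff]; simp [h0]
  refine ⟨fun h hm => ?_, fun h0 h hm => ?_, fun h0 h hm => ?_, fun h0 h => ?_, fun h hm => ?_⟩
  · obtain ⟨c, rfl⟩ := h
    have := S_eq' p hp n (p * c)
    rw [even_sum p hp n hm, if_pos (Dvd.intro _ rfl), ← mul_assoc, ← pow_succ] at this
    simp only [S]
    rw [this, Nat.totient_prime_pow_succ hp, Nat.cast_mul, Nat.cast_pow,
      Nat.cast_sub hp.one_le, Nat.cast_one]
  · have hv : padicValInt p β = n := by push_cast at h; omega
    have hn : ¬ (p : ℤ) ^ (n + 1) ∣ β := by rw [hdvd h0]; omega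
    obtain ⟨c, rfl⟩ := (hdvd h0 n).mpr (by omega)
    have := S_eq' p hp n c
    rw [even_sum p hp n hm, if_neg (fun hc => hn (by
      rw [pow_succ]; exact mul_dvd_mul_left _ hc))] at this
    simp only [S]
    rw [this]; simp
  · have hv : padicValInt p β = n := by push_cast at h; omega
    obtain ⟨c, rfl⟩ := (hdvd h0 n).mpr (by omega)
    have := S_eq' p hp n c
    rw [odd_sum p hp hp2 n hm] at this
    simp only [S]
    rw [this, Nat.add_sub_cancel, Int.mul_ediv_cancel_left _ (pow_ne_zero _ hpZ)]
    have hr : (p : ℝ) ^ (((n + 1 : ℕ) : ℝ) - 1 / 2) = (p : ℝ) ^ n * Real.sqrt p := by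
      rw [Real.sqrt_eq_rpow, ← Real.rpow_natCast, ← Real.rpow_add (by exact_mod_cast hp.pos)]
      congr 1; push_cast; ring
    rw [hr]; push_cast; ring
  · have hn : ¬ (p : ℤ) ^ n ∣ β := by rw [hdvd h0]; push_cast at h; omega
    have := S_eq p hp n β
    rw [if_neg hn, mul_zero] at this
    exact this
  · obtain ⟨c, rfl⟩ := h
    have := S_eq' p hp n (p * c)
    rw [odd_sum p hp hp2 n hm, jac_chi, ← mul_assoc ((p : ℤ) ^ n), ← pow_succ] at this
    simp only [S]
    rw [this]; simp [qchi_zero]
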